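/- Let s ∈ (0,1), let h : ℝ → ℝ be twice continuously differentiable, and let ε ∈ (0,1). Then there exist δ₁, δ₂ ∈ [0, ε/2] and a function v : ℝ → ℝ which is continuous on ℝ, twice continuously differentiable on (−1−ε, 1+ε), and has bounded support, such that: (i) |v(x) − h(x)| ≤ ε, |v'(x) − h'(x)| ≤ ε and |v''(x) − h''(x)| ≤ ε for every x ∈ (−1,1); (ii) for every x ∈ (−1−δ₁, 1+δ₂), the principal value integral (-∂²_x)^s v(x) := lim_{ρ→0⁺} ∫_{{y ∈ ℝ : |y−x| > ρ}} (v(x) − v(y))/|x−y|^{1+2s} dy exists and equals 0; (iii) for each x ∈ {−1−δ₁, 1+δ₂}, the limit of (v(x) − v(y))/|x−y|^s as y → x with y ∈ (−1−δ₁, 1+δ₂) exists and equals 0; (iv) v'(−1−δ₁) = v'(1+δ₂) = 0. -/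

import Mathlib

open MeasureTheory Filter

section FractionalLaplacian

open Set Topology

/-- `v` has a principal value fractional Laplacian of order `s` at `x`, equal to `c`. -/
structure HasFracLap (s : ℝ) (v : ℝ → ℝ) (x c : ℝ) : Prop where
  integrableOn : ∀ ρ : ℝ, 0 < ρ →
    IntegrableOn (fun y => (v x - v y) / |x - y| ^ (1 + 2 * s)) {y : ℝ | ρ < |y - x|}
  tendsto : Tendsto (fun ρ : ℝ => ∫ y in {y : ℝ | ρ < |y - x|},
    (v x - v y) / |x - y| ^ (1 + 2 * s)) (𝓝[>] 0) (𝓝 c)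

namespace HasFracLap

variable {s x c d : ℝ} {v w : ℝ → ℝ}

theorem add (hv : HasFracLap s v x c) (hw : HasFracLap s w x d) :
    HasFracLap s (fun y => v y + w y) x (c + d) := by
  have key : (fun y => (v x + w x - (v y + w y)) / |x - y| ^ (1 + 2 * s)) =
      fun y => (v x - v y) / |x - y| ^ (1 + 2 * s) + (w x - w y) / |x - y| ^ (1 + 2 * s) := by
    funext y; ring
  refine ⟨fun ρ hρ => ?_, ?_⟩
  · rw [key]; exact (hv.integrableOn ρ hρ).add (hw.integrableOn ρ hρ)
  · rw [key]
    refine (hv.tendsto.add hw.tendsto).congr' ?_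
    filter_upwards [self_mem_nhdsWithin] with ρ hρ
    exact (integral_add (hv.integrableOn ρ hρ) (hw.integrableOn ρ hρ)).symm

theorem const_mul (hv : HasFracLap s v x c) (r : ℝ) :
    HasFracLap s (fun y => r * v y) x (r * c) := by
  have key : (fun y => (r * v x - r * v y) / |x - y| ^ (1 + 2 * s)) =
      fun y => r * ((v x - v y) / |x - y| ^ (1 + 2 * s)) := by
    funext y; ring
  refine ⟨fun ρ hρ => ?_, ?_⟩
  · rw [key]; exact (hv.integrableOn ρ hρ).const_mul r
  · rw [key]
    refine (hv.tendsto.const_mul r).congr' (Eventually.of_forall fun ρ => ?_)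
    exact (integral_const_mul r _).symm

theorem comp_affine {a l : ℝ} (hl : 0 < l) (hv : HasFracLap s v (a + l * x) c) :
    HasFracLap s (fun y => v (a + l * y)) x (l ^ (2 * s) * c) := by
  have hmeas : ∀ z r : ℝ, MeasurableSet {y : ℝ | r < |y - z|} := fun z r =>
    (isOpen_lt continuous_const (by fun_prop)).measurableSet
  set X := a + l * x with hX
  let g : ℝ → ℝ → ℝ := fun ρ => indicator {Y : ℝ | l * ρ < |Y - X|}
    (fun Y => (v X - v Y) / |X - Y| ^ (1 + 2 * s))
  have hlp : l ^ (1 + 2 * s) = l * l ^ (2 * s) := by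
    rw [Real.rpow_add hl, Real.rpow_one]
  have key : ∀ ρ, indicator {y : ℝ | ρ < |y - x|}
      (fun y => (v (a + l * x) - v (a + l * y)) / |x - y| ^ (1 + 2 * s)) =
      fun y => l ^ (1 + 2 * s) * g ρ (a + l * y) := by
    intro ρ
    funext y
    have h1 : |a + l * y - X| = l * |y - x| := by
      rw [hX, ← abs_of_pos hl, ← abs_mul, abs_of_pos hl]; congr 1; ring
    have h2 : |X - (a + l * y)| = l * |x - y| := by
      rw [abs_sub_comm, h1, abs_sub_comm]
    have hlp : 0 < l ^ (1 + 2 * s) := Real.rpow_pos_of_pos hl _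
    simp only [g, indicator, mem_ofPred_eq, h1, h2, mul_lt_mul_iff_right₀ hl]
    split_ifs
    · rw [Real.mul_rpow hl.le (abs_nonneg _)]
      field_simp
      rfl
    · simp
  have hg : ∀ ρ, 0 < ρ → Integrable (g ρ) := fun ρ hρ =>
    (integrable_indicator_iff (hmeas _ _)).2 (hv.integrableOn _ (mul_pos hl hρ))
  refine ⟨fun ρ hρ => ?_, ?_⟩
  · rw [← integrable_indicator_iff (hmeas _ _), key]
    exact (((hg ρ hρ).comp_add_left a).comp_mul_left' hl.ne').const_mul _
  · have hlim : Tendsto (fun ρ : ℝ => l * ρ) (𝓝[>] 0) (𝓝[>] 0) := by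
      refine tendsto_nhdsWithin_iff.2 ⟨?_, ?_⟩
      · have : Tendsto (fun ρ : ℝ => l * ρ) (𝓝 0) (𝓝 (l * 0)) :=
          (continuous_const_mul l).tendsto 0
        rw [mul_zero] at this
        exact this.mono_left nhdsWithin_le_nhds
      · filter_upwards [self_mem_nhdsWithin] with ρ hρ using mul_pos hl hρ
    refine ((hv.tendsto.comp hlim).const_mul (l ^ (2 * s))).congr' (Eventually.of_forall fun ρ => ?_)
    simp only [Function.comp]
    rw [← integral_indicator (hmeas _ _), ← integral_indicator (hmeas _ _), key,
      integral_const_mul, hlp]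
    have := Measure.integral_comp_mul_left (fun y => g ρ (a + y)) l
    rw [this, integral_add_left_eq_self (g ρ) a, abs_of_pos (inv_pos.2 hl), smul_eq_mul]
    field_simp
    rfl

end HasFracLap

section Truncated

variable {s ρ : ℝ} {v : ℝ → ℝ} {M : ℝ}

theorem integrableOn_diffQuot (hs : 0 < s) (hv : Continuous v) (hM : ∀ y, |v y| ≤ M)
    (hρ : 0 < ρ) (x : ℝ) :
    IntegrableOn (fun r => (v x - v (x + r)) / r ^ (1 + 2 * s)) (Ioi ρ) := by
  have h1 : IntegrableOn (fun r : ℝ => 2 * M * r ^ (-(1 + 2 * s))) (Ioi ρ) :=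
    (integrableOn_Ioi_rpow_of_lt (by linarith) hρ).const_mul _
  refine Integrable.mono' h1 ?_ ?_
  · refine ContinuousOn.aestronglyMeasurable ?_ measurableSet_Ioi
    refine ContinuousOn.div (by fun_prop) ?_ ?_
    · exact continuousOn_id.rpow_const fun r hr => Or.inl (hρ.trans hr).ne'
    · exact fun r hr => (Real.rpow_pos_of_pos (hρ.trans hr) _).ne'
  · refine (ae_restrict_iff' measurableSet_Ioi).2 (Eventually.of_forall fun r hr => ?_)
    have hr0 : 0 < r := hρ.trans hr
    have hp : 0 < r ^ (1 + 2 * s) := Real.rpow_pos_of_pos hr0 _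
    rw [Real.norm_eq_abs, abs_div, abs_of_pos hp, Real.rpow_neg hr0.le, ← div_eq_mul_inv]
    gcongr
    calc |v x - v (x + r)| ≤ |v x| + |v (x + r)| := abs_sub _ _
      _ ≤ 2 * M := by linarith [hM x, hM (x + r)]

theorem preimage_add_abs (x ρ : ℝ) :
    (fun r => x + r) ⁻¹' {y : ℝ | ρ < |y - x|} = (-Ioi ρ) ∪ Ioi ρ := by
  ext r
  simp [lt_abs, or_comm, lt_neg]

theorem integrableOn_and_integral_trunc (hs : 0 < s) (hv : Continuous v) (hM : ∀ y, |v y| ≤ M)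
    (hρ : 0 < ρ) (x : ℝ) :
    IntegrableOn (fun y => (v x - v y) / |x - y| ^ (1 + 2 * s)) {y : ℝ | ρ < |y - x|} ∧
    ∫ y in {y : ℝ | ρ < |y - x|}, (v x - v y) / |x - y| ^ (1 + 2 * s) =
      (∫ r in Ioi ρ, (v x - v (x + r)) / r ^ (1 + 2 * s)) +
        ∫ r in Ioi ρ, (v x - v (x - r)) / r ^ (1 + 2 * s) := by
  have hR := integrableOn_diffQuot hs hv hM hρ x
  have hL : IntegrableOn (fun r => (v x - v (x - r)) / r ^ (1 + 2 * s)) (Ioi ρ) := by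
    have := integrableOn_diffQuot (v := fun y => v (-y)) hs (by fun_prop)
      (fun y => hM (-y)) hρ (-x)
    refine this.congr_fun (fun r _ => ?_) measurableSet_Ioi
    simp only [neg_neg]
    congr 3; ring_nf
  set g : ℝ → ℝ := fun y => (v x - v y) / |x - y| ^ (1 + 2 * s) with hg
  have hR' : IntegrableOn (fun r => g (x + r)) (Ioi ρ) := by
    refine hR.congr_fun (fun r hr => ?_) measurableSet_Ioi
    simp only [hg, sub_add_cancel_left, abs_neg, abs_of_pos (hρ.trans hr)]
  have hL0 : IntegrableOn (fun r => g (x - r)) (Ioi ρ) := by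
    refine hL.congr_fun (fun r hr => ?_) measurableSet_Ioi
    simp only [hg, sub_sub_cancel, abs_of_pos (hρ.trans hr)]
  have hL' : IntegrableOn (fun r => g (x + r)) (-Ioi ρ) := by
    have := hL0.comp_neg
    simpa only [sub_neg_eq_add] using this
  have hemb : MeasurableEmbedding (fun r : ℝ => x + r) := measurableEmbedding_addLeft x
  have hmp := measurePreserving_add_left (volume : Measure ℝ) x
  constructor
  · rw [← hmp.integrableOn_comp_preimage hemb, preimage_add_abs]
    exact hL'.union hR'
  · rw [← hmp.setIntegral_preimage_emb hemb, preimage_add_abs,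
      setIntegral_union _ measurableSet_Ioi hL' hR', add_comm]
    · congr 1
      · refine setIntegral_congr_fun measurableSet_Ioi fun r hr => ?_
        simp only [hg, sub_add_cancel_left, abs_neg, abs_of_pos (hρ.trans hr)]
      · rw [neg_Ioi, ← integral_Iic_eq_integral_Iio, ← integral_comp_neg_Ioi]
        refine setIntegral_congr_fun measurableSet_Ioi fun r hr => ?_
        simp only [hg, ← sub_eq_add_neg, sub_sub_cancel, abs_of_pos (hρ.trans hr)]
    · rw [Set.disjoint_left]
      intro r h1 h2
      simp only [neg_Ioi, mem_Iio, mem_Ioi] at h1 h2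
      linarith

end Truncated

section Torsion

/-- The torsion function of the interval `(-1, 1)`. -/
noncomputable def torsion (s : ℝ) (z : ℝ) : ℝ := (max (1 - z ^ 2) 0) ^ s

variable {s x t : ℝ}

theorem continuous_torsion (hs : 0 < s) : Continuous (torsion s) :=
  Continuous.rpow_const (by fun_prop) fun _ => Or.inr hs.le

theorem torsion_of_abs_le (h : z ^ 2 ≤ 1) : torsion s z = (1 - z ^ 2) ^ s := by
  rw [torsion, max_eq_left (by linarith)]

theorem torsion_eq_zero (hs : 0 < s) (h : 1 ≤ z ^ 2) : torsion s z = 0 := by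
  rw [torsion, max_eq_right (by linarith), Real.zero_rpow hs.ne']

theorem abs_torsion_le (hs : 0 < s) (z : ℝ) : |torsion s z| ≤ 1 := by
  have h : 0 ≤ max (1 - z ^ 2) 0 := le_max_right _ _
  rw [torsion, abs_of_nonneg (Real.rpow_nonneg h _)]
  refine Real.rpow_le_one h (max_le ?_ zero_le_one) hs.le
  nlinarith [sq_nonneg z]

theorem torsion_neg (z : ℝ) : torsion s (-z) = torsion s z := by simp [torsion]

/-- The density of the transformed kernel. -/
noncomputable def torsionKernel (s x τ : ℝ) : ℝ :=
  (1 - τ ^ 2) ^ s / (τ ^ (1 + 2 * s) * (1 + x * τ))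

theorem one_add_mul_pos (hx : x ∈ Ioo (-1 : ℝ) 1) (ht : t ∈ Icc (0 : ℝ) 1) : 0 < 1 + x * t := by
  obtain ⟨h1, h2⟩ := hx
  obtain ⟨h3, h4⟩ := ht
  nlinarith

theorem one_sub_sq_pos (hx : x ∈ Ioo (-1 : ℝ) 1) : 0 < 1 - x ^ 2 := by
  nlinarith [hx.1, hx.2]

theorem torsionKernel_comp (hx : x ∈ Ioo (-1 : ℝ) 1) (ht : t ∈ Ioc (0 : ℝ) 1) :
    torsion s (x + t * (1 - x ^ 2) / (1 + x * t)) / (t * (1 - x ^ 2) / (1 + x * t)) ^ (1 + 2 * s) *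
      ((1 - x ^ 2) / (1 + x * t) ^ 2) = ((1 - x ^ 2) ^ s)⁻¹ * torsionKernel s x t := by
  have hD := one_add_mul_pos hx ⟨ht.1.le, ht.2⟩
  have hβ := one_sub_sq_pos hx
  have ht0 := ht.1
  have h1t : 0 ≤ 1 - t ^ 2 := by nlinarith [ht.1, ht.2]
  set D := 1 + x * t with hDdef
  set β := 1 - x ^ 2 with hβdef
  have e1 : 1 - (x + t * β / D) ^ 2 = β * (1 - t ^ 2) / D ^ 2 := by
    field_simp
    rw [hDdef, hβdef]; ring
  have hsq : (x + t * β / D) ^ 2 ≤ 1 := by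
    have : 0 ≤ β * (1 - t ^ 2) / D ^ 2 := by positivity
    linarith
  have hexp : ∀ a : ℝ, 0 < a → a ^ (1 + 2 * s) = a * (a ^ 2) ^ s := by
    intro a ha
    rw [Real.rpow_add ha, Real.rpow_one, ← Real.rpow_natCast a 2, ← Real.rpow_mul ha.le]
    norm_num
  rw [torsion_of_abs_le hsq, e1, torsionKernel, ← hDdef, hexp _ (by positivity), hexp t ht0,
    Real.div_rpow (by positivity) (by positivity), Real.mul_rpow hβ.le h1t, div_pow, mul_pow,
    Real.div_rpow (by positivity) (by positivity), Real.mul_rpow (by positivity) (by positivity),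
    ← Real.rpow_natCast β 2, ← Real.rpow_mul hβ.le]
  have hb2 : β ^ (((2 : ℕ) : ℝ) * s) = β ^ s * β ^ s := by
    rw [← Real.rpow_add hβ]; congr 1; push_cast; ring
  rw [hb2]
  have p1 : 0 < β ^ s := Real.rpow_pos_of_pos hβ _
  have p2 : 0 < (D ^ 2) ^ s := Real.rpow_pos_of_pos (by positivity) _
  have p3 : 0 < (t ^ 2) ^ s := Real.rpow_pos_of_pos (by positivity) _
  field_simp

theorem continuousOn_torsionKernel (hs : 0 < s) (hx : x ∈ Ioo (-1 : ℝ) 1) (ht : 0 < t) :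
    ContinuousOn (torsionKernel s x) (Icc t 1) := by
  unfold torsionKernel
  refine ContinuousOn.div ?_ (ContinuousOn.mul ?_ (by fun_prop)) ?_
  · exact ContinuousOn.rpow_const (by fun_prop) fun _ _ => Or.inr hs.le
  · exact ContinuousOn.rpow_const (by fun_prop) fun r hr => Or.inl (ht.trans_le hr.1).ne'
  · intro r hr
    have hr0 := ht.trans_le hr.1
    exact (mul_pos (Real.rpow_pos_of_pos hr0 _) (one_add_mul_pos hx ⟨hr0.le, hr.2⟩)).ne'

theorem integral_torsion_eq (hs : 0 < s) (hx : x ∈ Ioo (-1 : ℝ) 1) (ht : t ∈ Ioc (0 : ℝ) 1) :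
    ∫ r in (t * (1 - x ^ 2) / (1 + x * t))..(1 - x), torsion s (x + r) / r ^ (1 + 2 * s) =
      ((1 - x ^ 2) ^ s)⁻¹ * ∫ τ in t..1, torsionKernel s x τ := by
  have hβ := one_sub_sq_pos hx
  have huIcc : uIcc t 1 = Icc t 1 := uIcc_of_le ht.2
  have hpos : ∀ τ ∈ Icc t 1, 0 < 1 + x * τ := fun τ hτ =>
    one_add_mul_pos hx ⟨(ht.1.trans_le hτ.1).le, hτ.2⟩
  have h1 : (1 : ℝ) - x = 1 * (1 - x ^ 2) / (1 + x * 1) := by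
    have : 1 + x * 1 ≠ 0 := by linarith [hx.1]
    rw [eq_div_iff this]
    ring
  have key := intervalIntegral.integral_comp_mul_deriv' (a := t) (b := 1)
    (f := fun τ => τ * (1 - x ^ 2) / (1 + x * τ)) (f' := fun τ => (1 - x ^ 2) / (1 + x * τ) ^ 2)
    (g := fun r => torsion s (x + r) / r ^ (1 + 2 * s)) ?_ ?_ ?_
  · rw [h1, ← key, ← intervalIntegral.integral_const_mul]
    refine intervalIntegral.integral_congr fun τ hτ => ?_
    rw [huIcc] at hτ
    exact torsionKernel_comp hx ⟨ht.1.trans_le hτ.1, hτ.2⟩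
  · intro τ hτ
    rw [huIcc] at hτ
    have hD := (hpos τ hτ).ne'
    have h2 : HasDerivAt (fun τ : ℝ => 1 + x * τ) x τ := by
      simpa using ((hasDerivAt_id τ).const_mul x).const_add 1
    have h3 : HasDerivAt (fun τ : ℝ => τ * (1 - x ^ 2)) (1 - x ^ 2) τ := by
      simpa using (hasDerivAt_id τ).mul_const (1 - x ^ 2)
    exact (h3.fun_div h2 hD).congr_deriv (by ring)
  · rw [huIcc]
    exact ContinuousOn.div (by fun_prop) (by fun_prop) fun τ hτ => (pow_pos (hpos τ hτ) 2).ne'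
  · rw [huIcc]
    refine ContinuousOn.div ?_ (ContinuousOn.rpow_const continuousOn_id ?_) ?_
    · exact ((continuous_torsion hs).comp (by fun_prop)).continuousOn
    all_goals
      rintro _ ⟨τ, hτ, rfl⟩
      have hτ0 := ht.1.trans_le hτ.1
      have hD := hpos τ hτ
      have : 0 < τ * (1 - x ^ 2) / (1 + x * τ) := by positivity
    · exact Or.inl this.ne'
    · exact (Real.rpow_pos_of_pos this _).ne'

theorem integral_diffQuot_torsion (hs : 0 < s) {ρ : ℝ} (hx : x ∈ Ioo (-1 : ℝ) 1) (hρ : 0 < ρ) :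
    ∫ r in Ioi ρ, (torsion s x - torsion s (x + r)) / r ^ (1 + 2 * s) =
      (1 - x ^ 2) ^ s * ρ ^ (-(2 * s)) / (2 * s) -
        ∫ r in ρ..(1 - x), torsion s (x + r) / r ^ (1 + 2 * s) := by
  have hzero : ∀ r ∈ Ioi (1 - x), torsion s (x + r) / r ^ (1 + 2 * s) = 0 := by
    intro r hr
    rw [mem_Ioi] at hr
    rw [torsion_eq_zero hs (by nlinarith), zero_div]
  have i1 : IntegrableOn (fun r : ℝ => torsion s x * r ^ (-(1 + 2 * s))) (Ioi ρ) :=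
    (integrableOn_Ioi_rpow_of_lt (by linarith) hρ).const_mul _
  have e1 : EqOn (fun r => (torsion s x - torsion s (x + r)) / r ^ (1 + 2 * s))
      (fun r => torsion s x * r ^ (-(1 + 2 * s)) - torsion s (x + r) / r ^ (1 + 2 * s)) (Ioi ρ) := by
    intro r hr
    simp only
    rw [Real.rpow_neg (hρ.trans hr).le]
    ring
  have i0 := integrableOn_diffQuot hs (continuous_torsion hs) (abs_torsion_le hs) hρ x
  have i2 : IntegrableOn (fun r => torsion s (x + r) / r ^ (1 + 2 * s)) (Ioi ρ) := by
    refine (i1.sub i0).congr_fun (fun r hr => ?_) measurableSet_Ioi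
    have := e1 hr
    simp only [Pi.sub_apply] at this ⊢
    rw [this]; ring
  have i3 : IntegrableOn (fun r => torsion s (x + r) / r ^ (1 + 2 * s)) (Ioi (1 - x)) :=
    (integrableOn_zero).congr_fun (fun r hr => (hzero r hr).symm) measurableSet_Ioi
  rw [setIntegral_congr_fun measurableSet_Ioi e1, integral_sub i1 i2,
    ← intervalIntegral.integral_interval_add_Ioi i2 i3, integral_const_mul,
    setIntegral_congr_fun measurableSet_Ioi hzero, integral_Ioi_rpow_of_lt (by linarith) hρ,
    torsion_of_abs_le (by nlinarith [hx.1, hx.2])]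
  have h2 : -(1 + 2 * s) + 1 = -(2 * s) := by ring
  rw [h2]
  simp only [integral_zero, add_zero]
  congr 1
  field_simp

end Torsion

section TorsionLimit

variable {s x t : ℝ}

theorem integrableOn_stieltjes (hs : s ∈ Ioo (0 : ℝ) 1) :
    IntegrableOn (fun u : ℝ => u ^ (s - 1) / (1 + u)) (Ioi 0) := by
  refine (Real.integrableOn_rpowIntegrand₀₁_Ioi hs zero_le_one).congr_fun (fun u hu => ?_)
    measurableSet_Ioi
  have hu0 : 0 < u := hu
  simp only [Real.rpowIntegrand₀₁, Real.rpow_sub_one hu0.ne']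
  field_simp
  ring

/-- The truncated Stieltjes integral which governs the torsion function. -/
noncomputable def stieltjes (s N : ℝ) : ℝ := ∫ u in (0 : ℝ)..N, u ^ (s - 1) / (1 + u)

theorem tendsto_stieltjes (hs : s ∈ Ioo (0 : ℝ) 1) :
    Tendsto (stieltjes s) atTop (𝓝 (∫ u in Ioi (0 : ℝ), u ^ (s - 1) / (1 + u))) :=
  intervalIntegral_tendsto_integral_Ioi 0 (integrableOn_stieltjes hs) tendsto_id

theorem hasDerivAt_stieltjes (hs : s ∈ Ioo (0 : ℝ) 1) {N : ℝ} (hN : 0 < N) :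
    HasDerivAt (stieltjes s) (N ^ (s - 1) / (1 + N)) N := by
  have hcont : ContinuousOn (fun u : ℝ => u ^ (s - 1) / (1 + u)) (Ioi 0) := by
    refine ContinuousOn.div (continuousOn_id.rpow_const fun u hu => Or.inl (ne_of_gt hu))
      (by fun_prop) fun u hu => ?_
    have : 0 < u := hu
    positivity
  refine intervalIntegral.integral_hasDerivAt_right ?_ ?_ ?_
  · rw [intervalIntegrable_iff_integrableOn_Ioc_of_le hN.le]
    exact (integrableOn_stieltjes hs).mono_set Ioc_subset_Ioi_self
  · exact hcont.stronglyMeasurableAtFilter isOpen_Ioi _ hN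
  · exact hcont.continuousAt (Ioi_mem_nhds hN)

theorem continuousOn_stieltjes (hs : s ∈ Ioo (0 : ℝ) 1) (b : ℝ) :
    ContinuousOn (stieltjes s) (Icc 0 b) := by
  rcases lt_or_ge b 0 with hb | hb
  · rw [Icc_eq_empty (not_le.2 hb)]; exact continuousOn_empty _
  have := intervalIntegral.continuousOn_primitive_interval (μ := volume)
    (f := fun u : ℝ => u ^ (s - 1) / (1 + u)) (a := 0) (b := b) ?_
  · rwa [uIcc_of_le hb] at this
  · rw [uIcc_of_le hb, integrableOn_Icc_iff_integrableOn_Ioc]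
    exact (integrableOn_stieltjes hs).mono_set Ioc_subset_Ioi_self

theorem integral_torsionKernel_add (hs : s ∈ Ioo (0 : ℝ) 1) (hx : x ∈ Ioo (-1 : ℝ) 1)
    (ht : t ∈ Ioc (0 : ℝ) 1) :
    (∫ τ in t..1, torsionKernel s x τ) + ∫ τ in t..1, torsionKernel s (-x) τ =
      (1 - x ^ 2) ^ s * (((1 - t ^ 2) / ((1 - x ^ 2) * t ^ 2)) ^ s / s -
        stieltjes s ((1 - t ^ 2) / ((1 - x ^ 2) * t ^ 2))) := by
  have hβ := one_sub_sq_pos hx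
  have hx' : -x ∈ Ioo (-1 : ℝ) 1 := ⟨by linarith [hx.2], by linarith [hx.1]⟩
  have hs0 := hs.1
  set β := 1 - x ^ 2 with hβdef
  have ii : ∀ y ∈ Ioo (-1 : ℝ) 1, IntervalIntegrable (torsionKernel s y) volume t 1 := by
    intro y hy
    refine ContinuousOn.intervalIntegrable ?_
    rw [uIcc_of_le ht.2]
    exact continuousOn_torsionKernel hs0 hy ht.1
  let N : ℝ → ℝ := fun τ => (1 - τ ^ 2) / (β * τ ^ 2)
  have hNc : ContinuousOn N (Icc t 1) := by
    refine ContinuousOn.div (by fun_prop) (by fun_prop) fun τ hτ => ?_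
    have := ht.1.trans_le hτ.1
    positivity
  have hN0 : ∀ τ ∈ Icc t 1, 0 ≤ N τ := by
    intro τ hτ
    have h0 := ht.1.trans_le hτ.1
    have : 0 ≤ 1 - τ ^ 2 := by nlinarith [hτ.2]
    positivity
  have hN1 : ∀ τ ∈ Icc t 1, N τ ≤ (β * t ^ 2)⁻¹ := by
    intro τ hτ
    have h0 := ht.1
    have h1 := hτ.1
    rw [inv_eq_one_div]
    simp only [N]
    gcongr
    nlinarith
  have key := intervalIntegral.integral_eq_sub_of_hasDerivAt_of_le (a := t) (b := 1) ht.2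
    (f := fun τ => β ^ s * (stieltjes s (N τ) - N τ ^ s / s))
    (f' := fun τ => torsionKernel s x τ + torsionKernel s (-x) τ) ?_ ?_ ?_
  · rw [← intervalIntegral.integral_add (ii x hx) (ii _ hx'), key]
    have : N 1 = 0 := by simp [N]
    have h0 : stieltjes s 0 = 0 := by simp [stieltjes]
    simp only [this, h0, Real.zero_rpow hs0.ne']
    simp only [N]
    ring
  · refine continuousOn_const.mul (ContinuousOn.sub ?_ ?_)
    · exact (continuousOn_stieltjes hs (β * t ^ 2)⁻¹).comp hNc fun τ hτ => ⟨hN0 τ hτ, hN1 τ hτ⟩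
    · exact (hNc.rpow_const fun _ _ => Or.inr hs0.le).div_const _
  · intro τ hτ
    have h0 := ht.1.trans hτ.1
    have h1 : 0 < 1 - τ ^ 2 := by nlinarith [hτ.2]
    have hNpos : 0 < N τ := by positivity
    have hN' : HasDerivAt N (-2 / (β * τ ^ 3)) τ := by
      have a1 : HasDerivAt (fun τ : ℝ => 1 - τ ^ 2) (-(2 * τ)) τ := by
        simpa using (hasDerivAt_pow 2 τ).const_sub 1
      have a2 : HasDerivAt (fun τ : ℝ => β * τ ^ 2) (β * (2 * τ)) τ := by
        simpa using (hasDerivAt_pow 2 τ).const_mul β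
      refine (a1.fun_div a2 (by positivity)).congr_deriv ?_
      field_simp
      ring
    have d1 := (hasDerivAt_stieltjes hs hNpos).comp τ hN'
    have d2 := (hN'.rpow_const (p := s) (Or.inl hNpos.ne')).div_const s
    refine ((d1.sub d2).const_mul (β ^ s)).congr_deriv ?_
    have p1 := one_add_mul_pos hx ⟨h0.le, hτ.2.le⟩
    have p2 := one_add_mul_pos hx' ⟨h0.le, hτ.2.le⟩
    have p3 : 1 + N τ = (1 + x * τ) * (1 + -x * τ) / (β * τ ^ 2) := by
      simp only [N]
      field_simp
      rw [hβdef]; ring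
    have p4 : N τ ^ s = (1 - τ ^ 2) ^ s / (β ^ s * (τ ^ 2) ^ s) := by
      simp only [N]
      rw [Real.div_rpow h1.le (by positivity), Real.mul_rpow hβ.le (by positivity)]
    have hexp : τ ^ (1 + 2 * s) = τ * (τ ^ 2) ^ s := by
      rw [Real.rpow_add h0, Real.rpow_one, ← Real.rpow_natCast τ 2, ← Real.rpow_mul h0.le]
      norm_num
    have q1 : 0 < β ^ s := Real.rpow_pos_of_pos hβ _
    have q3 : 0 < (τ ^ 2) ^ s := Real.rpow_pos_of_pos (by positivity) _
    have q4 : N τ ^ (s - 1) = N τ ^ s / N τ := Real.rpow_sub_one hNpos.ne' _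
    have goal1 : N τ ^ (s - 1) / (1 + N τ) * (-2 / (β * τ ^ 3)) -
        -2 / (β * τ ^ 3) * s * N τ ^ (s - 1) / s =
        N τ ^ s / (1 + N τ) * (2 / (β * τ ^ 3)) := by
      rw [q4]
      have : 0 < 1 + N τ := by positivity
      field_simp
      ring
    rw [goal1, p3, p4, torsionKernel, torsionKernel, hexp]
    have hsum : (1 + x * τ) + (1 + -x * τ) = 2 := by ring
    generalize 1 + x * τ = D₁ at *
    generalize 1 + -x * τ = D₂ at *
    rw [← hsum]
    field_simp
    ring
  · exact (ii x hx).add (ii _ hx')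

end TorsionLimit

section Analytic

theorem AnalyticAt.real_rpow_const {f : ℝ → ℝ} {x : ℝ} (hf : AnalyticAt ℝ f x) (hx : 0 < f x)
    (p : ℝ) : AnalyticAt ℝ (fun y => f y ^ p) x := by
  have h1 : AnalyticAt ℝ (fun y => Real.exp (Real.log (f y) * p)) x :=
    ((hf.log hx).mul analyticAt_const).rexp
  refine h1.congr ?_
  filter_upwards [hf.continuousAt.eventually (lt_mem_nhds hx)] with y hy
  exact (Real.rpow_def_of_pos hy p).symm

theorem AnalyticAt.isBigO_sq {f : ℝ → ℝ} (hf : AnalyticAt ℝ f 0) (h0 : f 0 = 0)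
    (h1 : HasDerivAt f 0 0) : f =O[𝓝 0] fun y => y ^ 2 := by
  have h := hf.hasFPowerSeriesAt.isBigO_sub_partialSum_pow 2
  simpa [FormalMultilinearSeries.partialSum, Finset.sum_range_succ,
    FormalMultilinearSeries.ofScalars_apply_eq, h0, h1.deriv] using h

end Analytic

section TorsionPV

variable {s x : ℝ}

theorem isBigO_rpow_bracket (s x : ℝ) :
    (fun t : ℝ => (1 + x * t) ^ (2 * s) + (1 - x * t) ^ (2 * s) - 2 * (1 - t ^ 2) ^ s)
      =O[𝓝 0] fun t => t ^ 2 := by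
  refine AnalyticAt.isBigO_sq ?_ ?_ ?_
  · have a1 : AnalyticAt ℝ (fun t : ℝ => (1 + x * t) ^ (2 * s)) 0 :=
      AnalyticAt.real_rpow_const (by fun_prop) (by norm_num) _
    have a2 : AnalyticAt ℝ (fun t : ℝ => (1 - x * t) ^ (2 * s)) 0 :=
      AnalyticAt.real_rpow_const (by fun_prop) (by norm_num) _
    have a3 : AnalyticAt ℝ (fun t : ℝ => (1 - t ^ 2) ^ s) 0 :=
      AnalyticAt.real_rpow_const (by fun_prop) (by norm_num) _
    exact (a1.add a2).sub (analyticAt_const.mul a3)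
  · norm_num
  · have d1 : HasDerivAt (fun t : ℝ => 1 + x * t) x 0 := by
      simpa using ((hasDerivAt_id (0 : ℝ)).const_mul x).const_add 1
    have d2 : HasDerivAt (fun t : ℝ => 1 - x * t) (-x) 0 := by
      simpa using ((hasDerivAt_id (0 : ℝ)).const_mul x).const_sub 1
    have d3 : HasDerivAt (fun t : ℝ => 1 - t ^ 2) 0 0 := by
      simpa using (hasDerivAt_pow 2 (0 : ℝ)).const_sub 1
    have e1 := d1.rpow_const (p := 2 * s) (Or.inl (by norm_num))
    have e2 := d2.rpow_const (p := 2 * s) (Or.inl (by norm_num))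
    have e3 := d3.rpow_const (p := s) (Or.inl (by norm_num))
    refine ((e1.add e2).sub (e3.const_mul 2)).congr_deriv ?_
    norm_num

theorem tendsto_rpow_mul_of_isBigO_sq (hs : s < 1) {φ : ℝ → ℝ}
    (hφ : φ =O[𝓝[>] 0] fun t => t ^ 2) :
    Tendsto (fun t : ℝ => t ^ (-(2 * s)) * φ t) (𝓝[>] 0) (𝓝 0) := by
  have h1 : (fun t : ℝ => t ^ (-(2 * s)) * φ t) =O[𝓝[>] 0] fun t => t ^ (2 - 2 * s) := by
    refine ((Asymptotics.isBigO_refl (fun t : ℝ => t ^ (-(2 * s))) _).mul hφ).congr'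
      (Eventually.of_forall fun _ => rfl) ?_
    filter_upwards [self_mem_nhdsWithin] with t ht
    have ht0 : (0 : ℝ) < t := ht
    rw [← Real.rpow_natCast t 2, ← Real.rpow_add ht0]
    congr 1; push_cast; ring
  refine h1.trans_tendsto ?_
  have h2 : Tendsto (fun t : ℝ => t ^ (2 - 2 * s)) (𝓝 0) (𝓝 (0 ^ (2 - 2 * s))) :=
    (Real.continuousAt_rpow_const 0 (2 - 2 * s) (Or.inr (by linarith))).tendsto
  rw [Real.zero_rpow (by linarith)] at h2
  exact h2.mono_left nhdsWithin_le_nhds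

/-- The one-sided truncated integral of the torsion function. -/
noncomputable def torsionSide (s x ρ : ℝ) : ℝ :=
  ∫ r in Ioi ρ, (torsion s x - torsion s (x + r)) / r ^ (1 + 2 * s)

theorem torsionSide_add (hs : s ∈ Ioo (0 : ℝ) 1) (hx : x ∈ Ioo (-1 : ℝ) 1) {t : ℝ}
    (ht : t ∈ Ioc (0 : ℝ) 1) :
    torsionSide s x (t * (1 - x ^ 2) / (1 + x * t)) +
        torsionSide s (-x) (t * (1 - x ^ 2) / (1 - x * t)) =
      stieltjes s ((1 - t ^ 2) / ((1 - x ^ 2) * t ^ 2)) +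
        ((1 - x ^ 2) ^ s)⁻¹ / (2 * s) * (t ^ (-(2 * s)) *
          ((1 + x * t) ^ (2 * s) + (1 - x * t) ^ (2 * s) - 2 * (1 - t ^ 2) ^ s)) := by
  have hs0 := hs.1
  have hβ := one_sub_sq_pos hx
  have ht0 := ht.1
  have hx' : -x ∈ Ioo (-1 : ℝ) 1 := ⟨by linarith [hx.2], by linarith [hx.1]⟩
  have hD1 := one_add_mul_pos hx ⟨ht.1.le, ht.2⟩
  have hD2 := one_add_mul_pos hx' ⟨ht.1.le, ht.2⟩
  have hD2' : 1 + -x * t = 1 - x * t := by ring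
  have h1t : 0 ≤ 1 - t ^ 2 := by nlinarith [ht.1, ht.2]
  have f1 := integral_torsion_eq hs0 hx ht
  have f2 := integral_torsion_eq hs0 hx' ht
  have f3 := integral_torsionKernel_add hs hx ht
  rw [hD2'] at hD2
  rw [neg_sq, hD2'] at f2
  have g1 := integral_diffQuot_torsion (s := s) (ρ := t * (1 - x ^ 2) / (1 + x * t)) hs0 hx
    (by positivity)
  have g2 := integral_diffQuot_torsion (s := s) (ρ := t * (1 - x ^ 2) / (1 - x * t)) hs0 hx'
    (by positivity)
  rw [neg_sq] at g2
  rw [torsionSide, torsionSide, g1, g2, f1, f2]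
  have hsum : ∀ a b c d e : ℝ, (a - b * c) + (d - b * e) = a + d - b * (c + e) := by
    intros; ring
  rw [hsum, f3]
  set β := 1 - x ^ 2
  have q1 : 0 < β ^ s := Real.rpow_pos_of_pos hβ _
  have q2 : 0 < (t ^ 2) ^ s := Real.rpow_pos_of_pos (by positivity) _
  have hb : β ^ (2 * s) = β ^ s * β ^ s := by
    rw [← Real.rpow_add hβ]; congr 1; ring
  have htt : t ^ (2 * s) = (t ^ 2) ^ s := by
    rw [← Real.rpow_natCast t 2, ← Real.rpow_mul ht0.le]; norm_num
  have e : ∀ D : ℝ, 0 < D → (t * β / D) ^ (-(2 * s)) =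
      ((t ^ 2) ^ s)⁻¹ * (β ^ s * β ^ s)⁻¹ * D ^ (2 * s) := by
    intro D hD
    have : 0 < D ^ (2 * s) := Real.rpow_pos_of_pos hD _
    rw [Real.rpow_neg (by positivity), Real.div_rpow (by positivity) hD.le,
      Real.mul_rpow ht0.le hβ.le, hb, htt]
    field_simp
  rw [e _ hD1, e _ hD2, Real.div_rpow h1t (by positivity), Real.mul_rpow hβ.le (by positivity),
    Real.rpow_neg ht0.le, htt]
  field_simp
  ring

theorem tendsto_torsionSide_add (hs : s ∈ Ioo (0 : ℝ) 1) (hx : x ∈ Ioo (-1 : ℝ) 1) :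
    Tendsto (fun t => torsionSide s x (t * (1 - x ^ 2) / (1 + x * t)) +
        torsionSide s (-x) (t * (1 - x ^ 2) / (1 - x * t))) (𝓝[>] 0)
      (𝓝 (∫ u in Ioi (0 : ℝ), u ^ (s - 1) / (1 + u))) := by
  have hβ := one_sub_sq_pos hx
  have h1 : Tendsto (fun t : ℝ => (1 - t ^ 2) / ((1 - x ^ 2) * t ^ 2)) (𝓝[>] 0) atTop := by
    have a1 : Tendsto (fun t : ℝ => (t ^ 2)⁻¹) (𝓝[>] 0) atTop := by
      refine Tendsto.inv_tendsto_nhdsGT_zero ?_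
      refine tendsto_nhdsWithin_iff.2 ⟨?_, ?_⟩
      · have : Tendsto (fun t : ℝ => t ^ 2) (𝓝 0) (𝓝 (0 ^ 2)) := (continuous_pow 2).tendsto 0
        rw [zero_pow two_ne_zero] at this
        exact this.mono_left nhdsWithin_le_nhds
      · filter_upwards [self_mem_nhdsWithin] with t ht using pow_pos (mem_Ioi.1 ht) 2
    have a2 : Tendsto (fun t : ℝ => (1 - t ^ 2) / (1 - x ^ 2)) (𝓝[>] 0)
        (𝓝 ((1 - 0 ^ 2) / (1 - x ^ 2))) :=
      (Continuous.tendsto (by fun_prop) 0).mono_left nhdsWithin_le_nhds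
    have := a2.pos_mul_atTop (by simpa using hβ) a1
    refine this.congr fun t => ?_
    rw [div_mul_eq_mul_div, ← div_eq_mul_inv, div_div, mul_comm (t ^ 2)]
  have h2 := ((tendsto_stieltjes hs).comp h1).add
    ((tendsto_rpow_mul_of_isBigO_sq hs.2
      ((isBigO_rpow_bracket s x).mono nhdsWithin_le_nhds)).const_mul
        (((1 - x ^ 2) ^ s)⁻¹ / (2 * s)))
  rw [mul_zero, add_zero] at h2
  refine h2.congr' ?_
  filter_upwards [Ioc_mem_nhdsGT (zero_lt_one' ℝ)] with t ht
  exact (torsionSide_add hs hx ht).symm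

end TorsionPV

section TorsionFracLap

variable {s x : ℝ}

theorem isBigO_torsion_sub (hx : x ∈ Ioo (-1 : ℝ) 1) :
    (fun r => torsion s x - torsion s (x + r)) =O[𝓝 0] fun r => r := by
  have hd : HasDerivAt (fun z : ℝ => 1 - z ^ 2) (-(2 * x)) x := by
    simpa using (hasDerivAt_pow 2 x).const_sub 1
  have hd2 := hd.rpow_const (p := s) (Or.inl (one_sub_sq_pos hx).ne')
  have hev : torsion s =ᶠ[𝓝 x] fun z => (1 - z ^ 2) ^ s := by
    filter_upwards [Ioo_mem_nhds hx.1 hx.2] with z hz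
    exact torsion_of_abs_le (by linarith [one_sub_sq_pos hz])
  have hd3 := (hd2.congr_of_eventuallyEq hev).isBigO_sub
  have htend : Tendsto (fun r : ℝ => x + r) (𝓝 0) (𝓝 x) := by
    simpa using (continuous_const_add x).tendsto (0 : ℝ)
  have := (hd3.comp_tendsto htend).neg_left
  refine this.congr (fun r => ?_) (fun r => ?_) <;> simp

theorem isBigO_torsionSide_sub (hs : s ∈ Ioo (0 : ℝ) 1) (hx : x ∈ Ioo (-1 : ℝ) 1) :
    (fun t => torsionSide s (-x) (t * (1 - x ^ 2) / (1 + x * t)) -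
      torsionSide s (-x) (t * (1 - x ^ 2) / (1 - x * t))) =O[𝓝[>] 0]
      fun t => t ^ (-(2 * s)) * t ^ 2 := by
  have hβ := one_sub_sq_pos hx
  have hs0 := hs.1
  have hx' : -x ∈ Ioo (-1 : ℝ) 1 := ⟨by linarith [hx.2], by linarith [hx.1]⟩
  have hβ1 : 1 - x ^ 2 ≤ 1 := by nlinarith [sq_nonneg x]
  obtain ⟨M, hM0, hM⟩ := (isBigO_torsion_sub (s := s) hx').exists_nonneg
  rw [Asymptotics.isBigOWith_iff] at hM
  obtain ⟨δ, hδ, hball⟩ := Metric.eventually_nhds_iff.1 hM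
  set β := 1 - x ^ 2
  refine Asymptotics.IsBigO.of_bound (M * (β / 2) ^ (-(2 * s)) * 8) ?_
  filter_upwards [Ioo_mem_nhdsGT (show (0 : ℝ) < min (1 / 2) (δ / 2) by positivity)] with t ht
  have ht0 := ht.1
  have ht1 : t < 1 / 2 := ht.2.trans_le (min_le_left _ _)
  have ht2 : t < δ / 2 := ht.2.trans_le (min_le_right _ _)
  have b1 : 1 / 2 ≤ 1 + x * t := by nlinarith [hx.1, hx.2]
  have b2 : 1 / 2 ≤ 1 - x * t := by nlinarith [hx.1, hx.2]
  have b3 : 1 + x * t ≤ 2 := by nlinarith [hx.1, hx.2]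
  have b4 : 1 - x * t ≤ 2 := by nlinarith [hx.1, hx.2]
  have lo : ∀ D : ℝ, 1 / 2 ≤ D → D ≤ 2 → t * (β / 2) ≤ t * β / D ∧ t * β / D ≤ 2 * t := by
    intro D h1 h2
    have hD : 0 < D := by linarith
    rw [le_div_iff₀ hD, div_le_iff₀ hD]
    constructor <;> nlinarith [mul_pos ht0 hβ]
  set ρ := t * β / (1 + x * t) with hρ
  set σ := t * β / (1 - x * t) with hσ
  obtain ⟨r1, r2⟩ := lo _ b1 b3
  obtain ⟨r3, r4⟩ := lo _ b2 b4
  have hm : 0 < t * (β / 2) := by positivity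
  have hdq := fun a (ha : 0 < a) =>
    integrableOn_diffQuot hs0 (continuous_torsion hs0) (abs_torsion_le hs0) ha (-x)
  have e1 : torsionSide s (-x) ρ - torsionSide s (-x) σ =
      ∫ r in ρ..σ, (torsion s (-x) - torsion s (-x + r)) / r ^ (1 + 2 * s) :=
    intervalIntegral.integral_Ioi_sub_Ioi' (hdq ρ (hm.trans_le r1)) (hdq σ (hm.trans_le r3))
  have e2 : |σ - ρ| ≤ 8 * t ^ 2 := by
    have : σ - ρ = 2 * x * β * t ^ 2 / ((1 + x * t) * (1 - x * t)) := by
      rw [hσ, hρ]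
      have : 0 < 1 + x * t := by linarith
      have : 0 < 1 - x * t := by linarith
      rw [div_sub_div _ _ (by positivity) (by positivity)]
      congr 1 <;> ring
    have hden : 1 / 4 ≤ (1 + x * t) * (1 - x * t) := by nlinarith
    rw [this, abs_div, abs_of_pos (a := (1 + x * t) * (1 - x * t)) (by linarith),
      div_le_iff₀ (by linarith), abs_mul, abs_mul, abs_mul, abs_of_pos hβ, abs_two,
      abs_of_pos (pow_pos ht0 2)]
    have hxa : |x| ≤ 1 := abs_le.2 ⟨hx.1.le, hx.2.le⟩
    have : |x| * β ≤ 1 * 1 := mul_le_mul hxa hβ1 hβ.le zero_le_one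
    nlinarith [pow_pos ht0 2]
  have e3 : ∀ r ∈ uIoc ρ σ, ‖(torsion s (-x) - torsion s (-x + r)) / r ^ (1 + 2 * s)‖ ≤
      M * (t * (β / 2)) ^ (-(2 * s)) := by
    intro r hr
    have h1 : t * (β / 2) ≤ r := (le_min r1 r3).trans hr.1.le
    have h2 : r ≤ 2 * t := hr.2.trans (max_le r2 r4)
    have hr0 : 0 < r := hm.trans_le h1
    have h3 := hball (y := r) (by rw [Real.dist_eq, sub_zero, abs_of_pos hr0]; linarith)
    rw [norm_div, Real.norm_of_nonneg (Real.rpow_pos_of_pos hr0 _).le,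
      div_le_iff₀ (Real.rpow_pos_of_pos hr0 _)]
    refine h3.trans ?_
    rw [Real.norm_of_nonneg hr0.le, mul_assoc]
    refine mul_le_mul_of_nonneg_left ?_ hM0
    calc r = r ^ (-(2 * s)) * r ^ (1 + 2 * s) := by
          rw [← Real.rpow_add hr0]; ring_nf; simp
      _ ≤ (t * (β / 2)) ^ (-(2 * s)) * r ^ (1 + 2 * s) := by
          refine mul_le_mul_of_nonneg_right ?_ (Real.rpow_pos_of_pos hr0 _).le
          exact Real.rpow_le_rpow_of_nonpos hm h1 (by linarith)
  rw [e1]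
  refine (intervalIntegral.norm_integral_le_of_norm_le_const e3).trans ?_
  have q1 : 0 < t ^ (-(2 * s)) := Real.rpow_pos_of_pos ht0 _
  have q2 : 0 < (β / 2) ^ (-(2 * s)) := Real.rpow_pos_of_pos (by positivity) _
  rw [Real.mul_rpow ht0.le (by positivity), Real.norm_of_nonneg (by positivity)]
  calc M * (t ^ (-(2 * s)) * (β / 2) ^ (-(2 * s))) * |σ - ρ|
      ≤ M * (t ^ (-(2 * s)) * (β / 2) ^ (-(2 * s))) * (8 * t ^ 2) := by gcongr
    _ = _ := by ring

/-- The torsion function has constant fractional Laplacian in the interval `(-1, 1)`. -/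
theorem hasFracLap_torsion (hs : s ∈ Ioo (0 : ℝ) 1) (hx : x ∈ Ioo (-1 : ℝ) 1) :
    HasFracLap s (torsion s) x (∫ u in Ioi (0 : ℝ), u ^ (s - 1) / (1 + u)) := by
  have hs0 := hs.1
  have hβ := one_sub_sq_pos hx
  have htr := fun ρ (hρ : 0 < ρ) => integrableOn_and_integral_trunc hs0 (continuous_torsion hs0)
    (abs_torsion_le hs0) hρ x
  refine ⟨fun ρ hρ => (htr ρ hρ).1, ?_⟩
  have hlim : Tendsto (fun t => torsionSide s x (t * (1 - x ^ 2) / (1 + x * t)) +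
        torsionSide s (-x) (t * (1 - x ^ 2) / (1 + x * t))) (𝓝[>] 0)
      (𝓝 (∫ u in Ioi (0 : ℝ), u ^ (s - 1) / (1 + u))) := by
    have h0 : Tendsto (fun t : ℝ => t ^ (-(2 * s)) * t ^ 2) (𝓝[>] 0) (𝓝 0) :=
      tendsto_rpow_mul_of_isBigO_sq hs.2 (Asymptotics.isBigO_refl _ _)
    have := (tendsto_torsionSide_add hs hx).add ((isBigO_torsionSide_sub hs hx).trans_tendsto h0)
    rw [add_zero] at this
    refine this.congr fun t => ?_
    ring
  have hcut : Tendsto (fun ρ : ℝ => ρ / (1 - x ^ 2 - x * ρ)) (𝓝[>] 0) (𝓝[>] 0) := by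
    have hc : ContinuousAt (fun ρ : ℝ => 1 - x ^ 2 - x * ρ) 0 := by fun_prop
    have hpos : ∀ᶠ ρ in 𝓝 (0 : ℝ), 0 < 1 - x ^ 2 - x * ρ :=
      hc.eventually (lt_mem_nhds (by simpa using hβ))
    refine tendsto_nhdsWithin_iff.2 ⟨?_, ?_⟩
    · have : ContinuousAt (fun ρ : ℝ => ρ / (1 - x ^ 2 - x * ρ)) 0 :=
        continuousAt_id.div hc (by simpa using hβ.ne')
      have h := this.tendsto
      rw [zero_div] at h
      exact h.mono_left nhdsWithin_le_nhds
    · filter_upwards [self_mem_nhdsWithin, nhdsWithin_le_nhds hpos] with ρ h1 h2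
      exact div_pos h1 h2
  refine (hlim.comp hcut).congr' ?_
  have hc : ContinuousAt (fun ρ : ℝ => 1 - x ^ 2 - x * ρ) 0 := by fun_prop
  have hpos : ∀ᶠ ρ in 𝓝 (0 : ℝ), 0 < 1 - x ^ 2 - x * ρ :=
    hc.eventually (lt_mem_nhds (by simpa using hβ))
  filter_upwards [self_mem_nhdsWithin, nhdsWithin_le_nhds hpos] with ρ h1 h2
  have e : ρ / (1 - x ^ 2 - x * ρ) * (1 - x ^ 2) /
      (1 + x * (ρ / (1 - x ^ 2 - x * ρ))) = ρ := by
    have : 1 + x * (ρ / (1 - x ^ 2 - x * ρ)) = (1 - x ^ 2) / (1 - x ^ 2 - x * ρ) := by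
      rw [eq_div_iff h2.ne', add_mul, mul_assoc, div_mul_cancel₀ _ h2.ne']; ring
    rw [this, div_mul_eq_mul_div, div_div_div_cancel_right₀ h2.ne', mul_div_assoc, div_self hβ.ne',
      mul_one]
  simp only [Function.comp, e]
  rw [(htr ρ h1).2, torsionSide, torsionSide]
  congr 1
  refine setIntegral_congr_fun measurableSet_Ioi fun r _ => ?_
  rw [torsion_neg, ← torsion_neg (-x + r)]
  congr 3; ring

end TorsionFracLap

section Harmonic

variable {s x : ℝ}

/-- A function with compact support which is `s`-harmonic in `(-1, 1)`. -/
noncomputable def harmonicModel (s y : ℝ) : ℝ := 4 ^ s * torsion s (0 + 1 / 2 * y) + -1 * torsion s y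

theorem continuous_harmonicModel (hs : 0 < s) : Continuous (harmonicModel s) := by
  have := continuous_torsion hs
  unfold harmonicModel
  fun_prop

theorem harmonicModel_eq_zero (hs : 0 < s) (hx : 2 ≤ |x|) : harmonicModel s x = 0 := by
  have : 4 ≤ x ^ 2 := by nlinarith [sq_abs x]
  rw [harmonicModel, torsion_eq_zero hs (by nlinarith), torsion_eq_zero hs (by nlinarith)]
  simp

theorem hasFracLap_harmonicModel (hs : s ∈ Ioo (0 : ℝ) 1) (hx : x ∈ Ioo (-1 : ℝ) 1) :
    HasFracLap s (harmonicModel s) x 0 := by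
  have h1 := hasFracLap_torsion hs hx
  have h2 := (HasFracLap.comp_affine (s := s) (a := 0) (l := 1 / 2) (x := x) (by norm_num)
    (hasFracLap_torsion hs ⟨by linarith [hx.1], by linarith [hx.2]⟩)).const_mul (4 ^ s)
  have h3 := h2.add (h1.const_mul (-1))
  have : (4 : ℝ) ^ s * (1 / 2) ^ (2 * s) = 1 := by
    rw [Real.rpow_mul (by norm_num), ← Real.mul_rpow (by norm_num) (by positivity)]
    norm_num
  rw [← mul_assoc, this] at h3
  rw [one_mul, neg_one_mul, add_neg_cancel] at h3
  exact h3

theorem harmonicModel_eq (hx : x ∈ Ioo (-1 : ℝ) 1) :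
    harmonicModel s x = (4 - x ^ 2) ^ s - (1 - x ^ 2) ^ s := by
  have := one_sub_sq_pos hx
  rw [harmonicModel, torsion_of_abs_le (by nlinarith), torsion_of_abs_le (by linarith),
    ← Real.mul_rpow (by norm_num) (by nlinarith)]
  ring_nf

theorem harmonicModel_eventuallyEq (hx : x ∈ Ioo (-1 : ℝ) 1) :
    harmonicModel s =ᶠ[𝓝 x] fun z => (4 - z ^ 2) ^ s - (1 - z ^ 2) ^ s := by
  filter_upwards [Ioo_mem_nhds hx.1 hx.2] with z hz using harmonicModel_eq hz

theorem analyticAt_harmonicModel (hx : x ∈ Ioo (-1 : ℝ) 1) : AnalyticAt ℝ (harmonicModel s) x := by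
  have := one_sub_sq_pos hx
  refine AnalyticAt.congr ?_ (harmonicModel_eventuallyEq hx).symm
  have h4 := AnalyticAt.real_rpow_const (f := fun z => 4 - z ^ 2) (x := x) (by fun_prop)
    (by linarith) s
  have h1 := AnalyticAt.real_rpow_const (f := fun z => 1 - z ^ 2) (x := x) (by fun_prop) this s
  exact h4.sub h1

theorem deriv_harmonicModel (hx : x ∈ Ioo (-1 : ℝ) 1) :
    deriv (harmonicModel s) x = 2 * s * x * ((1 - x ^ 2) ^ (s - 1) - (4 - x ^ 2) ^ (s - 1)) := by
  have := one_sub_sq_pos hx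
  have hd : ∀ c : ℝ, HasDerivAt (fun z : ℝ => c - z ^ 2) (-(2 * x)) x := fun c => by
    simpa using (hasDerivAt_pow 2 x).const_sub c
  have h1 := (hd 4).rpow_const (p := s) (Or.inl (by linarith))
  have h2 := (hd 1).rpow_const (p := s) (Or.inl (by linarith))
  rw [(harmonicModel_eventuallyEq hx).deriv_eq, (h1.fun_sub h2).deriv]
  ring

theorem not_bounded_deriv_harmonicModel (hs : s ∈ Ioo (0 : ℝ) 1) {M : ℝ} (hM : 0 ≤ M) :
    ∃ x ∈ Ioo (-1 : ℝ) 1, M < |deriv (harmonicModel s) x| := by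
  have hs0 := hs.1
  have ht : Tendsto (fun τ : ℝ => τ ^ (s - 1)) (𝓝[>] 0) atTop :=
    tendsto_rpow_neg_nhdsGT_zero (by linarith [hs.2])
  have h1 := (ht.eventually_gt_atTop (M / s + 1)).and
    (Ioo_mem_nhdsGT (show (0 : ℝ) < 3 / 4 by norm_num))
  obtain ⟨τ, hτ, hτ0, hτ1⟩ := h1.exists
  have hq : (√(1 - τ)) ^ 2 = 1 - τ := Real.sq_sqrt (by linarith)
  have hq0 : 0 ≤ √(1 - τ) := Real.sqrt_nonneg _
  have hx : √(1 - τ) ∈ Ioo (-1 : ℝ) 1 := ⟨by linarith, by nlinarith⟩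
  have hx2 : 1 / 2 ≤ √(1 - τ) := by nlinarith
  refine ⟨_, hx, ?_⟩
  rw [deriv_harmonicModel hx, hq, sub_sub_cancel]
  have h4 : (4 - (1 - τ)) ^ (s - 1) ≤ 1 :=
    Real.rpow_le_one_of_one_le_of_nonpos (by linarith) (by linarith [hs.2])
  refine lt_of_lt_of_le ?_ (le_abs_self _)
  have h5 : M / s < τ ^ (s - 1) - (4 - (1 - τ)) ^ (s - 1) := by linarith
  have h6 : M < s * (τ ^ (s - 1) - (4 - (1 - τ)) ^ (s - 1)) := by
    rwa [div_lt_iff₀' hs0] at h5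
  refine h6.trans_le ?_
  refine mul_le_mul_of_nonneg_right ?_ ?_
  · nlinarith
  · nlinarith [div_nonneg hM hs0.le]

theorem exists_iteratedDeriv_harmonicModel_ne_zero (hs : s ∈ Ioo (0 : ℝ) 1) (k : ℕ) :
    ∃ a ∈ Ioo (-1 : ℝ) 1, iteratedDeriv k (harmonicModel s) a ≠ 0 := by
  by_contra! H
  have hdiff : ∀ j, ∀ x ∈ Ioo (-1 : ℝ) 1, DifferentiableAt ℝ (iteratedDeriv j (harmonicModel s)) x :=
    fun j x hx => by
      rw [iteratedDeriv_eq_iterate]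
      exact ((analyticAt_harmonicModel hx).iterated_deriv j).differentiableAt
  have step : ∀ j, (∃ M, ∀ x ∈ Ioo (-1 : ℝ) 1, |iteratedDeriv (j + 1) (harmonicModel s) x| ≤ M) →
      ∃ M, ∀ x ∈ Ioo (-1 : ℝ) 1, |iteratedDeriv j (harmonicModel s) x| ≤ M := by
    rintro j ⟨M, hM⟩
    have h0 : (0 : ℝ) ∈ Ioo (-1 : ℝ) 1 := by norm_num
    refine ⟨|iteratedDeriv j (harmonicModel s) 0| + M, fun x hx => ?_⟩
    have hM0 : 0 ≤ M := (abs_nonneg _).trans (hM 0 h0)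
    have := (convex_Ioo (-1 : ℝ) 1).norm_image_sub_le_of_norm_deriv_le (hdiff j)
      (fun y hy => by rw [← iteratedDeriv_succ]; exact hM y hy) h0 hx
    simp only [Real.norm_eq_abs, sub_zero] at this
    have hx1 : |x| ≤ 1 := abs_le.2 ⟨hx.1.le, hx.2.le⟩
    have := this.trans (mul_le_mul_of_nonneg_left hx1 hM0)
    have h3 := abs_sub_abs_le_abs_sub (iteratedDeriv j (harmonicModel s) x)
      (iteratedDeriv j (harmonicModel s) 0)
    linarith
  have hev : ∀ x ∈ Ioo (-1 : ℝ) 1, iteratedDeriv (k + 1) (harmonicModel s) x = 0 := by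
    intro x hx
    have : iteratedDeriv k (harmonicModel s) =ᶠ[𝓝 x] fun _ => 0 := by
      filter_upwards [Ioo_mem_nhds hx.1 hx.2] with z hz using H z hz
    rw [iteratedDeriv_succ, this.deriv_eq, deriv_const]
  have all : ∀ i ≤ k, ∃ M, ∀ x ∈ Ioo (-1 : ℝ) 1,
      |iteratedDeriv (k + 1 - i) (harmonicModel s) x| ≤ M := by
    intro i
    induction i with
    | zero => exact fun _ => ⟨0, fun x hx => by simp [hev x hx]⟩
    | succ i ih =>
      intro hi
      refine step _ ?_
      rw [show k + 1 - (i + 1) + 1 = k + 1 - i by omega]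
      exact ih (by omega)
  obtain ⟨M, hM⟩ := all k le_rfl
  obtain ⟨x, hx, hlt⟩ := not_bounded_deriv_harmonicModel hs
    ((abs_nonneg _).trans (hM 0 (by norm_num)))
  have := hM x hx
  rw [show k + 1 - k = 1 by omega, iteratedDeriv_one] at this
  linarith

end Harmonic

section Approximation

/-- A continuous function of bounded support which is of class `C²` and `s`-harmonic in
`(-R, R)`. -/
structure IsHarmonicOn (s R : ℝ) (v : ℝ → ℝ) : Prop where
  continuous : Continuous v
  isBounded : Bornology.IsBounded (Function.support v)
  contDiffOn : ContDiffOn ℝ 2 v (Ioo (-R) R)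
  hasFracLap : ∀ x ∈ Ioo (-R) R, HasFracLap s v x 0

/-- `f` is a limit of `s`-harmonic functions in the `C²` norm of `(-R, R)`. -/
structure HarmonicApprox (s R : ℝ) (f : ℝ → ℝ) : Prop where
  contDiffOn : ContDiffOn ℝ 2 f (Ioo (-R) R)
  exists_near : ∀ η : ℝ, 0 < η → ∃ v, IsHarmonicOn s R v ∧ ∀ i ≤ 2, ∀ x ∈ Ioo (-R) R,
    |iteratedDeriv i v x - iteratedDeriv i f x| ≤ η

variable {s R r : ℝ} {f g v w : ℝ → ℝ}

theorem ContDiffOn.contDiffAt_nat {i : ℕ} {x : ℝ} (hf : ContDiffOn ℝ 2 f (Ioo (-R) R)) (hi : i ≤ 2)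
    (hx : x ∈ Ioo (-R) R) : ContDiffAt ℝ i f x :=
  (hf.contDiffAt (Ioo_mem_nhds hx.1 hx.2)).of_le (by exact_mod_cast hi)

namespace IsHarmonicOn

theorem add (hv : IsHarmonicOn s R v) (hw : IsHarmonicOn s R w) :
    IsHarmonicOn s R (fun x => v x + w x) where
  continuous := hv.continuous.add hw.continuous
  isBounded := (hv.isBounded.union hw.isBounded).subset (Function.support_add v w)
  contDiffOn := hv.contDiffOn.add hw.contDiffOn
  hasFracLap x hx := by simpa using (hv.hasFracLap x hx).add (hw.hasFracLap x hx)

theorem const_mul (hv : IsHarmonicOn s R v) (r : ℝ) : IsHarmonicOn s R (fun x => r * v x) where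
  continuous := hv.continuous.const_mul r
  isBounded := hv.isBounded.subset (Function.support_const_smul_subset r v)
  contDiffOn := contDiffOn_const.mul hv.contDiffOn
  hasFracLap x hx := by simpa using (hv.hasFracLap x hx).const_mul r

theorem harmonicApprox (hv : IsHarmonicOn s R v) : HarmonicApprox s R v :=
  ⟨hv.contDiffOn, fun η hη => ⟨v, hv, fun i _ x _ => by simpa using hη.le⟩⟩

end IsHarmonicOn

namespace HarmonicApprox

theorem add (hf : HarmonicApprox s R f) (hg : HarmonicApprox s R g) :
    HarmonicApprox s R (fun x => f x + g x) := by
  refine ⟨hf.contDiffOn.add hg.contDiffOn, fun η hη => ?_⟩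
  obtain ⟨v, hv, hvf⟩ := hf.exists_near (η / 2) (half_pos hη)
  obtain ⟨w, hw, hwg⟩ := hg.exists_near (η / 2) (half_pos hη)
  refine ⟨_, hv.add hw, fun i hi x hx => ?_⟩
  rw [iteratedDeriv_fun_add (hv.contDiffOn.contDiffAt_nat hi hx) (hw.contDiffOn.contDiffAt_nat hi hx),
    iteratedDeriv_fun_add (hf.contDiffOn.contDiffAt_nat hi hx) (hg.contDiffOn.contDiffAt_nat hi hx),
    add_sub_add_comm]
  exact (abs_add_le _ _).trans (by linarith [hvf i hi x hx, hwg i hi x hx])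

theorem const_mul (hf : HarmonicApprox s R f) (r : ℝ) : HarmonicApprox s R (fun x => r * f x) := by
  refine ⟨contDiffOn_const.mul hf.contDiffOn, fun η hη => ?_⟩
  have hr : 0 < |r| + 1 := by positivity
  obtain ⟨v, hv, hvf⟩ := hf.exists_near (η / (|r| + 1)) (by positivity)
  refine ⟨_, hv.const_mul r, fun i hi x hx => ?_⟩
  rw [iteratedDeriv_const_mul_field, iteratedDeriv_const_mul_field, ← mul_sub, abs_mul]
  have h1 := hvf i hi x hx
  rw [le_div_iff₀ hr] at h1
  nlinarith [abs_nonneg (iteratedDeriv i v x - iteratedDeriv i f x)]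

theorem of_forall_exists (hf : ContDiffOn ℝ 2 f (Ioo (-R) R))
    (H : ∀ η : ℝ, 0 < η → ∃ g, HarmonicApprox s R g ∧ ∀ i ≤ 2, ∀ x ∈ Ioo (-R) R,
      |iteratedDeriv i g x - iteratedDeriv i f x| ≤ η) : HarmonicApprox s R f := by
  refine ⟨hf, fun η hη => ?_⟩
  obtain ⟨g, hg, hgf⟩ := H (η / 2) (half_pos hη)
  obtain ⟨v, hv, hvg⟩ := hg.exists_near (η / 2) (half_pos hη)
  refine ⟨v, hv, fun i hi x hx => (abs_sub_le _ (iteratedDeriv i g x) _).trans ?_⟩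
  linarith [hvg i hi x hx, hgf i hi x hx]

end HarmonicApprox

theorem iteratedDeriv_comp_mul_left (n : ℕ) (f : ℝ → ℝ) (c x : ℝ) :
    iteratedDeriv n (fun y => f (c * y)) x = c ^ n * iteratedDeriv n f (c * x) := by
  induction n generalizing x with
  | zero => simp
  | succ n ih =>
    rw [iteratedDeriv_succ, funext ih, deriv_const_mul_field, deriv_comp_mul_left,
      iteratedDeriv_succ, smul_eq_mul]
    ring

/-- Blowing up an analytic function at `0` produces its leading term. -/
theorem eventually_iteratedDeriv_pow_mul_comp_near (hf : AnalyticAt ℝ f 0) (k i : ℕ) (R : ℝ) {η : ℝ}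
    (hη : 0 < η) : ∀ᶠ l in 𝓝 (0 : ℝ), ∀ x ∈ Icc (-R) R,
      |iteratedDeriv i (fun y => y ^ k * f (l * y)) x - iteratedDeriv i (fun y => f 0 * y ^ k) x| ≤ η := by
  refine isCompact_Icc.eventually_forall_of_forall_eventually fun x _ => ?_
  have hm : Tendsto (fun z : ℝ × ℝ => z.1 * z.2) (𝓝 (0, x)) (𝓝 0) := by
    have : Continuous fun z : ℝ × ℝ => z.1 * z.2 := by fun_prop
    simpa using this.tendsto (0, x)
  have hP : ∀ j, Continuous (iteratedDeriv j fun y : ℝ => y ^ k) := fun j =>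
    (contDiff_id.pow k).continuous_iteratedDeriv j le_top
  have hF : ∀ j, Tendsto (fun z : ℝ × ℝ => iteratedDeriv j f (z.1 * z.2)) (𝓝 (0, x))
      (𝓝 (iteratedDeriv j f 0)) := fun j => by
    have : ContinuousAt (iteratedDeriv j f) 0 := by
      rw [iteratedDeriv_eq_iterate]; exact (hf.iterated_deriv j).continuousAt
    exact this.tendsto.comp hm
  have hlim : Tendsto (fun z : ℝ × ℝ => (∑ j ∈ Finset.range (i + 1), (i.choose j : ℝ) *
        iteratedDeriv j (fun y => y ^ k) z.2 *
        (z.1 ^ (i - j) * iteratedDeriv (i - j) f (z.1 * z.2))) -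
        f 0 * iteratedDeriv i (fun y => y ^ k) z.2) (𝓝 (0, x))
      (𝓝 ((∑ j ∈ Finset.range (i + 1), (i.choose j : ℝ) *
        iteratedDeriv j (fun y => y ^ k) x * (0 ^ (i - j) * iteratedDeriv (i - j) f 0)) -
        f 0 * iteratedDeriv i (fun y => y ^ k) x)) := by
    refine Tendsto.sub (tendsto_finsetSum _ fun j _ => ?_) ?_
    · refine Tendsto.mul (Tendsto.mul tendsto_const_nhds ?_) (Tendsto.mul ?_ (hF _))
      · exact ((hP j).comp continuous_snd).tendsto (0, x)
      · exact ((continuous_fst (X := ℝ) (Y := ℝ)).pow (i - j)).tendsto (0, x)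
    · exact Tendsto.mul tendsto_const_nhds (((hP i).comp continuous_snd).tendsto (0, x))
  rw [Finset.sum_range_succ, Finset.sum_eq_zero, zero_add] at hlim
  · simp only [Nat.choose_self, Nat.cast_one, one_mul, Nat.sub_self, pow_zero, iteratedDeriv_zero]
      at hlim
    rw [mul_comm (f 0), sub_self] at hlim
    filter_upwards [hlim.abs.eventually_le_const (u := η) (by simpa using hη),
      hm.eventually hf.eventually_analyticAt] with z hz hza
    have hc : ContDiffAt ℝ i (fun y => f (z.1 * y)) z.2 :=
      (AnalyticAt.comp (g := f) (f := fun y => z.1 * y) hza (by fun_prop)).contDiffAt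
    rw [iteratedDeriv_fun_mul (f := fun y => y ^ k) (by fun_prop) hc, iteratedDeriv_const_mul_field]
    simpa only [iteratedDeriv_comp_mul_left] using hz
  · intro j hj
    rw [zero_pow (by have := Finset.mem_range.1 hj; omega)]
    simp

theorem HarmonicApprox.blowup (hf : AnalyticAt ℝ f 0) {k : ℕ}
    (H : ∀ᶠ l in 𝓝[>] (0 : ℝ), HarmonicApprox s R (fun x => x ^ k * f (l * x))) :
    HarmonicApprox s R (fun x => f 0 * x ^ k) ∧
      ∀ᶠ l in 𝓝[>] (0 : ℝ), HarmonicApprox s R (fun x => x ^ (k + 1) * dslope f 0 (l * x)) := by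
  have h0 : HarmonicApprox s R (fun x => f 0 * x ^ k) := by
    refine .of_forall_exists (by fun_prop) fun η hη => ?_
    have hev : ∀ i, ∀ᶠ l in 𝓝[>] (0 : ℝ), ∀ x ∈ Icc (-R) R,
        |iteratedDeriv i (fun y => y ^ k * f (l * y)) x -
          iteratedDeriv i (fun y => f 0 * y ^ k) x| ≤ η := fun i =>
      nhdsWithin_le_nhds (eventually_iteratedDeriv_pow_mul_comp_near hf k i R hη)
    have hall := (Set.finite_Iic 2).eventually_all (l := 𝓝[>] (0 : ℝ)) |>.2 fun i _ => hev i
    obtain ⟨l, hl, hl'⟩ := (H.and hall).exists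
    exact ⟨_, hl, fun i hi x hx => hl' i hi x (Ioo_subset_Icc_self hx)⟩
  refine ⟨h0, ?_⟩
  filter_upwards [H, self_mem_nhdsWithin] with l hl hl0
  have hl0 : 0 < l := hl0
  have := (hl.add (h0.const_mul (-1))).const_mul l⁻¹
  refine (funext fun x => ?_ : (fun x => x ^ (k + 1) * dslope f 0 (l * x)) = _) ▸ this
  have hd := sub_smul_dslope f 0 (l * x)
  rw [sub_zero, smul_eq_mul] at hd
  rw [eq_inv_mul_iff_mul_eq₀ hl0.ne']
  linear_combination x ^ k * hd

theorem HarmonicApprox.blowup_iterate (hf : AnalyticAt ℝ f 0)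
    (H : ∀ᶠ l in 𝓝[>] (0 : ℝ), HarmonicApprox s R (fun x => f (l * x))) (k : ℕ) :
    HarmonicApprox s R (fun x => iteratedDeriv k f 0 / k.factorial * x ^ k) := by
  have hp := hf.hasFPowerSeriesAt
  have han : ∀ k, HasFPowerSeriesAt _ _ _ := fun k => hp.has_fpower_series_iterate_dslope_fslope k
  have hall : ∀ k, ∀ᶠ l in 𝓝[>] (0 : ℝ),
      HarmonicApprox s R (fun x => x ^ k * (Function.swap dslope 0)^[k] f (l * x)) := by
    intro k
    induction k with
    | zero => simpa using H
    | succ k ih =>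
      rw [Function.iterate_succ']
      exact (HarmonicApprox.blowup (han k).analyticAt ih).2
  have hk := (HarmonicApprox.blowup (han k).analyticAt (hall k)).1
  have hc : (Function.swap dslope 0)^[k] f 0 = iteratedDeriv k f 0 / k.factorial := by
    have := (han k).coeff_zero 1
    rw [← this, ← FormalMultilinearSeries.coeff, FormalMultilinearSeries.coeff_iterate_fslope]
    simp [FormalMultilinearSeries.coeff_ofScalars]
  rwa [hc] at hk

end Approximation

section Density

open Polynomial

variable {s R : ℝ}

theorem isHarmonicOn_harmonicModel_comp (hs : s ∈ Ioo (0 : ℝ) 1) {a l : ℝ} (hl : 0 < l)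
    (ha : ∀ x ∈ Ioo (-R) R, a + l * x ∈ Ioo (-1 : ℝ) 1) :
    IsHarmonicOn s R (fun x => harmonicModel s (a + l * x)) where
  continuous := (continuous_harmonicModel hs.1).comp (by fun_prop)
  isBounded := by
    refine (Metric.isBounded_closedBall (x := (0 : ℝ)) (r := (2 + |a|) / l)).subset fun x hx => ?_
    rw [mem_closedBall_zero_iff, Real.norm_eq_abs, le_div_iff₀ hl]
    have h2 : |a + l * x| < 2 := by
      by_contra! h2
      exact hx (harmonicModel_eq_zero hs.1 h2)
    have := abs_sub (a + l * x) a
    rw [add_sub_cancel_left, abs_mul, abs_of_pos hl] at this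
    linarith
  contDiffOn x hx := by
    refine (AnalyticAt.contDiffAt ?_).contDiffWithinAt
    exact (analyticAt_harmonicModel (ha x hx)).comp (f := fun x => a + l * x) (by fun_prop)
  hasFracLap x hx := by
    simpa using (hasFracLap_harmonicModel hs (ha x hx)).comp_affine hl

theorem harmonicApprox_pow (hs : s ∈ Ioo (0 : ℝ) 1) (k : ℕ) :
    HarmonicApprox s R (fun x => x ^ k) := by
  obtain ⟨a, ha, hk⟩ := exists_iteratedDeriv_harmonicModel_ne_zero hs k
  have han : AnalyticAt ℝ (fun y => harmonicModel s (a + y)) 0 :=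
    AnalyticAt.comp (g := harmonicModel s) (f := fun y => a + y)
      (analyticAt_harmonicModel (by simpa using ha)) (by fun_prop)
  have hev : ∀ᶠ l in 𝓝[>] (0 : ℝ), HarmonicApprox s R (fun x => harmonicModel s (a + l * x)) := by
    have : ∀ᶠ l in 𝓝 (0 : ℝ), ∀ x ∈ Icc (-R) R, a + l * x ∈ Ioo (-1 : ℝ) 1 := by
      refine isCompact_Icc.eventually_forall_of_forall_eventually fun x _ => ?_
      have hc : Continuous fun z : ℝ × ℝ => a + z.1 * z.2 := by fun_prop
      exact (hc.tendsto (0, x)).eventually_mem (isOpen_Ioo.mem_nhds (by simpa using ha))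
    filter_upwards [self_mem_nhdsWithin, nhdsWithin_le_nhds this] with l hl h
    exact (isHarmonicOn_harmonicModel_comp hs hl
      fun x hx => h x (Ioo_subset_Icc_self hx)).harmonicApprox
  have hc := HarmonicApprox.blowup_iterate han hev k
  rw [iteratedDeriv_comp_const_add] at hc
  simp only [add_zero] at hc
  have hne : iteratedDeriv k (harmonicModel s) a / k.factorial ≠ 0 :=
    div_ne_zero hk (by positivity)
  refine (funext fun x => ?_ : (fun x : ℝ => x ^ k) = _) ▸
    hc.const_mul (iteratedDeriv k (harmonicModel s) a / k.factorial)⁻¹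
  rw [inv_mul_cancel_left₀ hne]

theorem harmonicApprox_polynomial (hs : s ∈ Ioo (0 : ℝ) 1) (p : ℝ[X]) :
    HarmonicApprox s R (fun x => p.eval x) := by
  induction p using Polynomial.induction_on' with
  | add p q hp hq => simpa using hp.add hq
  | monomial n a => simpa using (harmonicApprox_pow hs n).const_mul a

theorem Polynomial.exists_derivative_eq (p : ℝ[X]) (c : ℝ) :
    ∃ q : ℝ[X], derivative q = p ∧ q.eval 0 = c := by
  have : ∃ q : ℝ[X], derivative q = p := by
    induction p using Polynomial.induction_on' with
    | add p q hp hq =>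
      obtain ⟨P, rfl⟩ := hp
      obtain ⟨Q, rfl⟩ := hq
      exact ⟨P + Q, derivative_add⟩
    | monomial n a =>
      refine ⟨monomial (n + 1) (a / (n + 1)), ?_⟩
      rw [derivative_monomial_succ, div_mul_cancel₀ _ (by positivity)]
  obtain ⟨q, rfl⟩ := this
  exact ⟨q + C (c - q.eval 0), by simp, by simp⟩

theorem abs_sub_le_of_abs_deriv_sub_le {f g : ℝ → ℝ} {η : ℝ} (hf : Differentiable ℝ f)
    (hg : Differentiable ℝ g) (h0 : f 0 = g 0) (hη : 0 ≤ η)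
    (h : ∀ x ∈ Icc (-R) R, |deriv f x - deriv g x| ≤ η) {x : ℝ} (hx : x ∈ Icc (-R) R) :
    |f x - g x| ≤ η * R := by
  have hR : 0 ≤ R := by linarith [hx.1, hx.2]
  have hd : ∀ y, deriv (fun z => f z - g z) y = deriv f y - deriv g y := fun y =>
    deriv_fun_sub (hf y) (hg y)
  have := (convex_Icc (-R) R).norm_image_sub_le_of_norm_deriv_le (f := fun z => f z - g z)
    (fun y _ => (hf y).sub (hg y)) (fun y hy => by rw [hd]; exact h y hy)
    (show (0 : ℝ) ∈ Icc (-R) R by constructor <;> linarith) hx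
  simp only [h0, sub_self, sub_zero, Real.norm_eq_abs] at this
  exact this.trans (mul_le_mul_of_nonneg_left (abs_le.2 hx) hη)

/-- Every function of class `C²` is a limit of `s`-harmonic functions in the `C²` norm. -/
theorem harmonicApprox_of_contDiff (hs : s ∈ Ioo (0 : ℝ) 1) {f : ℝ → ℝ} (hf : ContDiff ℝ 2 f) :
    HarmonicApprox s R f := by
  refine .of_forall_exists hf.contDiffOn fun η hη => ?_
  have hf1 : ContDiff ℝ 1 (deriv f) := hf.deriv'
  have hf2 : Continuous (deriv (deriv f)) := hf1.continuous_deriv le_rfl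
  set κ := η / (1 + R ^ 2) with hκ
  have hκ0 : 0 < κ := by positivity
  obtain ⟨p, hp⟩ := exists_polynomial_near_of_continuousOn (-R) R _ hf2.continuousOn κ hκ0
  obtain ⟨q, rfl, hq0⟩ := Polynomial.exists_derivative_eq p (deriv f 0)
  obtain ⟨P, rfl, hP0⟩ := Polynomial.exists_derivative_eq q (f 0)
  have d1 : deriv (fun x => P.eval x) = fun x => (derivative P).eval x := funext fun x => P.deriv
  have d2 : deriv (fun x => (derivative P).eval x) = fun x => (derivative (derivative P)).eval x :=
    funext fun x => Polynomial.deriv _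
  have h2 : ∀ x ∈ Icc (-R) R, |(derivative (derivative P)).eval x - deriv (deriv f) x| ≤ κ :=
    fun x hx => (hp x hx).le
  have h1 : ∀ x ∈ Icc (-R) R, |(derivative P).eval x - deriv f x| ≤ κ * R := fun x hx =>
    abs_sub_le_of_abs_deriv_sub_le (derivative P).differentiable (hf1.differentiable one_ne_zero)
      hq0 hκ0.le (by rwa [d2]) hx
  refine ⟨_, harmonicApprox_polynomial hs P, fun i hi x hx => ?_⟩
  have hx := Ioo_subset_Icc_self hx
  have hR : 0 ≤ R := by linarith [hx.1, hx.2]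
  have h0 : |P.eval x - f x| ≤ κ * R * R :=
    abs_sub_le_of_abs_deriv_sub_le P.differentiable (hf.differentiable two_ne_zero)
      hP0 (by positivity) (by rwa [d1]) hx
  have hη' : κ * (1 + R ^ 2) = η := div_mul_cancel₀ _ (by positivity)
  interval_cases i
  · simp only [iteratedDeriv_zero]
    nlinarith
  · simp only [iteratedDeriv_one, d1]
    nlinarith [h1 x hx, sq_nonneg (R - 1)]
  · simp only [iteratedDeriv_succ, iteratedDeriv_zero, d1, d2]
    nlinarith [h2 x hx, mul_nonneg hκ0.le (sq_nonneg R)]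

end Density

section Endpoints

variable {s : ℝ}

theorem tendsto_diffQuot_rpow_abs (hs : s < 1) {v : ℝ → ℝ} {x : ℝ} (hv : DifferentiableAt ℝ v x) :
    Tendsto (fun y => (v x - v y) / |x - y| ^ s) (𝓝 x) (𝓝 0) := by
  obtain ⟨M, hM⟩ := hv.hasDerivAt.isBigO_sub.bound
  have hlim : Tendsto (fun y => M * |x - y| ^ (1 - s)) (𝓝 x) (𝓝 0) := by
    have hc : Continuous fun y : ℝ => M * |x - y| ^ (1 - s) :=
      continuous_const.mul (Continuous.rpow_const (by fun_prop) fun _ => Or.inr (by linarith))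
    have := hc.tendsto x
    rwa [sub_self, abs_zero, Real.zero_rpow (by linarith), mul_zero] at this
  refine squeeze_zero_norm' ?_ hlim
  filter_upwards [hM] with y hy
  rcases eq_or_ne y x with rfl | hyx
  · simp [Real.zero_rpow (show 1 - s ≠ 0 by linarith)]
  have hpos : 0 < |x - y| := abs_pos.2 (sub_ne_zero.2 hyx.symm)
  rw [norm_div, Real.norm_of_nonneg (Real.rpow_pos_of_pos hpos s).le,
    div_le_iff₀ (Real.rpow_pos_of_pos hpos s), mul_assoc, ← Real.rpow_add hpos, sub_add_cancel,
    Real.rpow_one, norm_sub_rev, abs_sub_comm]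
  exact hy

/-- A local perturbation of a `C²` function whose derivative takes both signs. -/
theorem exists_contDiff_deriv_pos_neg {h : ℝ → ℝ} (hh : ContDiff ℝ 2 h) (c : ℝ) {r : ℝ}
    (hr : 0 < r) : ∃ H : ℝ → ℝ, ContDiff ℝ 2 H ∧ (∀ x, r ≤ |x - c| → H x = h x) ∧
      ∃ ξ₁ ∈ Ioo (c - r) (c + r), ∃ ξ₂ ∈ Ioo (c - r) (c + r),
        0 < deriv H ξ₁ ∧ deriv H ξ₂ < 0 := by
  let φ : ContDiffBump c := ⟨r / 2, r, by positivity, by linarith⟩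
  let A := |h (c - r)| + |h (c + r)| + |h c| + 1
  have hH : ContDiff ℝ 2 fun x => h x + A * φ x := hh.add (contDiff_const.mul φ.contDiff)
  have hout : ∀ x, r ≤ |x - c| → h x + A * φ x = h x := fun x hx => by
    rw [φ.zero_of_le_dist (by rwa [Real.dist_eq]), mul_zero, add_zero]
  have hin : φ c = 1 := φ.one_of_mem_closedBall (Metric.mem_closedBall_self φ.rIn_pos.le)
  have hd := hH.differentiable two_ne_zero
  have e1 := hout (c - r) (by rw [sub_sub_cancel_left, abs_neg, abs_of_pos hr])
  have e2 := hout (c + r) (by rw [add_sub_cancel_left, abs_of_pos hr])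
  obtain ⟨ξ₁, h1, h1'⟩ := exists_deriv_eq_slope (fun x => h x + A * φ x)
    (show c - r < c by linarith) hd.continuous.continuousOn hd.differentiableOn
  obtain ⟨ξ₂, h2, h2'⟩ := exists_deriv_eq_slope (fun x => h x + A * φ x)
    (show c < c + r by linarith) hd.continuous.continuousOn hd.differentiableOn
  have b1 := le_abs_self (h (c - r))
  have b2 := le_abs_self (h (c + r))
  have b3 := neg_abs_le (h c)
  have b4 := abs_nonneg (h (c - r))
  have b5 := abs_nonneg (h (c + r))
  refine ⟨_, hH, hout, ξ₁, ⟨h1.1, by linarith [h1.2]⟩, ξ₂, ⟨by linarith [h2.1], h2.2⟩, ?_, ?_⟩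
  · rw [h1', hin, e1]
    exact div_pos (by simp only [A]; linarith) (by linarith)
  · rw [h2', hin, e2]
    exact div_neg_of_neg_of_pos (by simp only [A]; linarith) (by linarith)

theorem exists_deriv_eq_zero_of_pos_neg {v : ℝ → ℝ} {a b ξ₁ ξ₂ : ℝ}
    (hv : ContinuousOn (deriv v) (Ioo a b)) (h1 : ξ₁ ∈ Ioo a b) (h2 : ξ₂ ∈ Ioo a b)
    (hpos : 0 < deriv v ξ₁) (hneg : deriv v ξ₂ < 0) : ∃ z ∈ Ioo a b, deriv v z = 0 := by
  have hsub : uIcc ξ₁ ξ₂ ⊆ Ioo a b := ordConnected_Ioo.uIcc_subset h1 h2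
  obtain ⟨z, hz, hz0⟩ := intermediate_value_uIcc (hv.mono hsub)
    (show (0 : ℝ) ∈ uIcc _ _ from ⟨(min_le_right _ _).trans hneg.le, hpos.le.trans (le_max_left _ _)⟩)
  exact ⟨z, hsub hz, hz0⟩

end Endpoints

end FractionalLaplacian

/-- Example 1.7 (EXAMPLE): for `s ∈ (0,1)`, `h ∈ C²(ℝ)` and `ε ∈ (0,1)`, there exist
`δ₁, δ₂ ∈ [0, ε/2]` and a continuous, boundedly supported `v`, of class `C²` on
`(−1−ε, 1+ε)`, with `‖v−h‖_{C²((−1,1))} ≤ ε`, which is `s`-harmonic on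
`(−1−δ₁, 1+δ₂)` (in the principal-value sense), has vanishing fractional normal
derivative at the endpoints `−1−δ₁`, `1+δ₂`, and `v'(−1−δ₁) = v'(1+δ₂) = 0`. -/
theorem stmt_9 (s : ℝ) (hs : s ∈ Set.Ioo (0 : ℝ) 1)
    (h : ℝ → ℝ) (hh : ContDiff ℝ 2 h) (ε : ℝ) (hε : ε ∈ Set.Ioo (0 : ℝ) 1) :
    ∃ δ₁ δ₂ : ℝ, δ₁ ∈ Set.Icc 0 (ε / 2) ∧ δ₂ ∈ Set.Icc 0 (ε / 2) ∧
      ∃ v : ℝ → ℝ,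
        Continuous v ∧
        ContDiffOn ℝ 2 v (Set.Ioo (-1 - ε) (1 + ε)) ∧
        Bornology.IsBounded (Function.support v) ∧
        (∀ x ∈ Set.Ioo (-1 : ℝ) 1,
          |v x - h x| ≤ ε ∧ |deriv v x - deriv h x| ≤ ε ∧
            |deriv (deriv v) x - deriv (deriv h) x| ≤ ε) ∧
        (∀ x ∈ Set.Ioo (-1 - δ₁) (1 + δ₂),
          (∀ ρ : ℝ, 0 < ρ →
            IntegrableOn (fun y => (v x - v y) / |x - y| ^ (1 + 2 * s))
              {y : ℝ | ρ < |y - x|}) ∧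
          Tendsto (fun ρ : ℝ => ∫ y in {y : ℝ | ρ < |y - x|},
              (v x - v y) / |x - y| ^ (1 + 2 * s))
            (nhdsWithin 0 (Set.Ioi 0)) (nhds 0)) ∧
        (∀ x ∈ ({-1 - δ₁, 1 + δ₂} : Set ℝ),
          Tendsto (fun y => (v x - v y) / |x - y| ^ s)
            (nhdsWithin x (Set.Ioo (-1 - δ₁) (1 + δ₂))) (nhds 0)) ∧
        deriv v (-1 - δ₁) = 0 ∧ deriv v (1 + δ₂) = 0 := by
  obtain ⟨hε0, hε1⟩ := hε
  have hr : 0 < ε / 8 := by positivity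
  obtain ⟨H₁, hH₁, hout₁, ξ₁, hξ₁, ξ₂, hξ₂, hpos₁, hneg₁⟩ :=
    exists_contDiff_deriv_pos_neg hh (1 + ε / 4) hr
  obtain ⟨H, hH, hout, ζ₁, hζ₁, ζ₂, hζ₂, hpos, hneg⟩ :=
    exists_contDiff_deriv_pos_neg hH₁ (-1 - ε / 4) hr
  have hright : ∀ x, -1 < x → H x = H₁ x := fun x hx =>
    hout x (by rw [abs_of_pos (by linarith)]; linarith)
  have hmid : ∀ x ∈ Set.Ioo (-1 : ℝ) 1, H x = h x := fun x hx => by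
    rw [hright x hx.1, hout₁ x (by rw [abs_of_neg (by linarith [hx.2])]; linarith [hx.2])]
  have hderiv : ∀ x, -1 < x → deriv H x = deriv H₁ x := fun x hx =>
    Filter.EventuallyEq.deriv_eq (by filter_upwards [lt_mem_nhds hx] with z hz using hright z hz)
  rw [← hderiv ξ₁ (by linarith [hξ₁.1])] at hpos₁
  rw [← hderiv ξ₂ (by linarith [hξ₂.1])] at hneg₁
  obtain ⟨η, hη0, hη⟩ : ∃ η > 0, η ≤ ε ∧ η < deriv H ξ₁ ∧ η < -deriv H ξ₂ ∧ η < deriv H ζ₁ ∧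
      η < -deriv H ζ₂ := by
    have hev : ∀ a : ℝ, 0 < a → ∀ᶠ η in nhdsWithin (0 : ℝ) (Set.Ioi 0), η < a := fun a ha =>
      nhdsWithin_le_nhds (gt_mem_nhds ha)
    have := (hev ε hε0).and ((hev _ hpos₁).and ((hev _ (neg_pos.2 hneg₁)).and
      ((hev _ hpos).and (hev _ (neg_pos.2 hneg)))))
    obtain ⟨η, ⟨h1, h2⟩, h3⟩ := (this.and self_mem_nhdsWithin).exists
    exact ⟨η, h3, h1.le, h2⟩
  obtain ⟨hηε, hη₁, hη₂, hη₃, hη₄⟩ := hη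
  obtain ⟨v, hv, hvH⟩ := (harmonicApprox_of_contDiff (R := 1 + ε) hs hH).exists_near η hη0
  have hC2 := hv.contDiffOn
  have hlap := hv.hasFracLap
  rw [show -(1 + ε) = -1 - ε by ring] at hC2 hlap hvH
  have hvd : ContinuousOn (deriv v) (Set.Ioo (-1 - ε) (1 + ε)) :=
    hC2.continuousOn_deriv_of_isOpen isOpen_Ioo (by norm_num)
  have hclose : ∀ x ∈ Set.Ioo (-1 - ε) (1 + ε), |deriv v x - deriv H x| ≤ η := fun x hx => by
    simpa using hvH 1 (by norm_num) x hx
  have hsub₂ : Set.Ioo (1 + ε / 4 - ε / 8) (1 + ε / 4 + ε / 8) ⊆ Set.Ioo (-1 - ε) (1 + ε) :=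
    Set.Ioo_subset_Ioo (by linarith) (by linarith)
  have hsub₁ : Set.Ioo (-1 - ε / 4 - ε / 8) (-1 - ε / 4 + ε / 8) ⊆ Set.Ioo (-1 - ε) (1 + ε) :=
    Set.Ioo_subset_Ioo (by linarith) (by linarith)
  obtain ⟨z₂, hz₂, hz₂0⟩ := exists_deriv_eq_zero_of_pos_neg (hvd.mono hsub₂) hξ₁ hξ₂
    (by linarith [(abs_le.1 (hclose ξ₁ (hsub₂ hξ₁))).1])
    (by linarith [(abs_le.1 (hclose ξ₂ (hsub₂ hξ₂))).2])
  obtain ⟨z₁, hz₁, hz₁0⟩ := exists_deriv_eq_zero_of_pos_neg (hvd.mono hsub₁) hζ₁ hζ₂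
    (by linarith [(abs_le.1 (hclose ζ₁ (hsub₁ hζ₁))).1])
    (by linarith [(abs_le.1 (hclose ζ₂ (hsub₁ hζ₂))).2])
  have hdiff : ∀ x ∈ Set.Ioo (-1 - ε) (1 + ε), DifferentiableAt ℝ v x := fun x hx =>
    (hC2.contDiffAt (Ioo_mem_nhds hx.1 hx.2)).differentiableAt two_ne_zero
  refine ⟨-1 - z₁, z₂ - 1, ⟨by linarith [hz₁.2], by linarith [hz₁.1]⟩,
    ⟨by linarith [hz₂.1], by linarith [hz₂.2]⟩, v, hv.continuous, hC2, hv.isBounded, ?_, ?_, ?_, ?_, ?_⟩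
  · intro x hx
    have hx' : x ∈ Set.Ioo (-1 - ε) (1 + ε) := ⟨by linarith [hx.1], by linarith [hx.2]⟩
    have hev : H =ᶠ[nhds x] h := by
      filter_upwards [Ioo_mem_nhds hx.1 hx.2] with z hz using hmid z hz
    rw [← hev.deriv_eq, ← hev.deriv.deriv_eq, ← hmid x hx]
    refine ⟨?_, (hclose x hx').trans hηε, ?_⟩
    · simpa using (hvH 0 (by norm_num) x hx').trans hηε
    · simpa [iteratedDeriv_succ] using (hvH 2 le_rfl x hx').trans hηε
  · intro x hx
    have := hlap x ⟨by linarith [hx.1, hz₁.1], by linarith [hx.2, hz₂.2]⟩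
    exact ⟨this.integrableOn, this.tendsto⟩
  · intro x hx
    refine (tendsto_diffQuot_rpow_abs hs.2 (hdiff x ?_)).mono_left nhdsWithin_le_nhds
    rcases hx with rfl | rfl
    · rw [sub_sub_cancel]; exact hsub₁ hz₁
    · rw [add_sub_cancel]; exact hsub₂ hz₂
  · rwa [sub_sub_cancel]
  · rwa [add_sub_cancel]
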